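/- For every real T > 0 and every q ∈ ℂ with |q| < 1, H*(T;q) = (1 − 1/T) · Σ_{n≥0} (T² − 1)^n q^{2n² + n} / ( (q²;q²)_n (−q;q²)_{n+1} ) + (1/T) · Σ_{n≥0} (T² − 1)^n q^{2n² − n} / ( (q²;q²)_n (−q;q²)_n ), with both series converging absolutely. -/

import Mathlib

open scoped Real Classical
open Complex Filter Asymptotics

noncomputable section

/-- The conjugate part `λ'_k`: the number of parts of `P` that are at least `k`. -/
def colLen {n : ℕ} (P : n.Partition) (k : ℕ) : ℕ :=
  Multiset.card (P.parts.filter (fun p => k ≤ p))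

/-- The part `λ_j` (the `j`-th largest part, 1-indexed), recovered by conjugating twice. -/
def rowLen {n : ℕ} (P : n.Partition) (j : ℕ) : ℕ :=
  ((Finset.Icc 1 n).filter (fun k => j ≤ colLen P k)).card

/-- The hook number `h(j,k) = (λ_j - j) + (λ'_k - k) + 1` of the cell `(j,k)` (1-indexed). -/
def hookNum {n : ℕ} (P : n.Partition) (j k : ℕ) : ℤ :=
  ((rowLen P j : ℤ) - j) + ((colLen P k : ℤ) - k) + 1

/-- `N_t(λ)`: the number of cells of the Young diagram of `λ` with hook number `t`. -/
def Nhook {n : ℕ} (t : ℕ) (P : n.Partition) : ℕ :=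
  (((Finset.Icc 1 n) ×ˢ (Finset.Icc 1 n)).filter
    (fun c => c.2 ≤ rowLen P c.1 ∧ hookNum P c.1 c.2 = (t : ℤ))).card

/-- A partition is self-conjugate if `λ_k = λ'_k` for all `k ≥ 1`. -/
def IsSelfConjugate {n : ℕ} (P : n.Partition) : Prop :=
  ∀ k, 1 ≤ k → rowLen P k = colLen P k

/-- `SC(n)`, the set of self-conjugate partitions of `n`. -/
def SC (n : ℕ) : Finset (Nat.Partition n) :=
  Finset.univ.filter (fun P => IsSelfConjugate P)

/-- `δ_t = 1` if `t` is odd, else `0`. -/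
def delta (t : ℕ) : ℝ := if Odd t then 1 else 0

/-- The region `D_θ = { r e^{iα} : r ≥ 0, |α| ≤ θ }`. -/
def Dset (θ : ℝ) : Set ℂ := {z | z = 0 ∨ |z.arg| ≤ θ}

/-- The filter of punctured neighborhoods of `0` intersected with `D_θ`. -/
def near0 (θ : ℝ) : Filter ℂ := nhdsWithin 0 (Dset θ \ {0})

/-- The dilogarithm `Li₂(X) = -∫₀¹ log(1 - Xu)/u du` (principal logarithm). -/
def Li2 (X : ℂ) : ℂ := -∫ u in (0:ℝ)..1, Complex.log (1 - X * u) / (u : ℂ)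

/-- The real dilogarithm, for real arguments `x < 1`. -/
def Li2R (x : ℝ) : ℝ := -∫ u in (0:ℝ)..1, Real.log (1 - x * u) / u

/-- The principal complex square root. -/
def csqrt (z : ℂ) : ℂ := z ^ ((1:ℂ)/2)

/-- The infinite Pochhammer symbol `(a;q)_∞ = ∏_{j ≥ 0} (1 - a q^j)`. -/
def pochInf (a q : ℂ) : ℂ := ∏' j : ℕ, (1 - a * q ^ j)

/-- The finite Pochhammer symbol `(a;q)_n = ∏_{j=0}^{n-1} (1 - a q^j)`. -/
def pochN (a q : ℂ) (n : ℕ) : ℂ := ∏ j ∈ Finset.range n, (1 - a * q ^ j)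

/-- `C_T^+ = 1 + √((1-T)/(1+T))`. -/
def Cp (T : ℝ) : ℂ := 1 + csqrt ((1 - (T:ℂ)) / (1 + (T:ℂ)))

/-- `C_T^- = 1 - √((1-T)/(1+T))`. -/
def Cm (T : ℝ) : ℂ := 1 - csqrt ((1 - (T:ℂ)) / (1 + (T:ℂ)))

/-- `H*(T;q) = (1/(2T)) [ C_T^+ (√(1-T²);-q)_∞ + C_T^- (-√(1-T²);-q)_∞ ]`. -/
def Hstar (T : ℝ) (q : ℂ) : ℂ :=
  1 / (2 * (T:ℂ)) * (Cp T * pochInf (csqrt (1 - (T:ℂ)^2)) (-q)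
    + Cm T * pochInf (-csqrt (1 - (T:ℂ)^2)) (-q))

/-- `α_T^+ = (1/(2T)) ( C_T^+ + C_T^- √((1+√(1-T²))/(1-√(1-T²))) )`. -/
def alphaP (T : ℝ) : ℂ :=
  1 / (2 * (T:ℂ)) *
    (Cp T + Cm T * csqrt ((1 + csqrt (1 - (T:ℂ)^2)) / (1 - csqrt (1 - (T:ℂ)^2))))

/-- `α_T^- = (1/(2T)) ( C_T^+ - C_T^- √((1+√(1-T²))/(1-√(1-T²))) )`. -/
def alphaM (T : ℝ) : ℂ :=
  1 / (2 * (T:ℂ)) *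
    (Cp T - Cm T * csqrt ((1 + csqrt (1 - (T:ℂ)^2)) / (1 - csqrt (1 - (T:ℂ)^2))))

/-- `b_t(T)` from Proposition: saddle-point constant. -/
def bt (t : ℕ) (T : ℝ) : ℝ :=
  if Even t then (1/2) * Real.sqrt (π^2/6 - Li2R (1 - T^2))
  else (1/2) * Real.sqrt (π^2/6 - ((t-1 : ℝ)/t) * Li2R (1 - T^2))

end

/-- The `n`-th coefficient of Euler's expansion of `(x;p)_∞` in powers of `x`. -/
noncomputable def eulerCoeff (p : ℂ) (n : ℕ) : ℂ :=
  (-1) ^ n * p ^ (n.choose 2) / pochN p p n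

theorem one_sub_pow_succ_ne_zero {p : ℂ} (hp : ‖p‖ < 1) (n : ℕ) : 1 - p ^ (n + 1) ≠ 0 := by
  intro h
  have h1 : ‖p ^ (n + 1)‖ = 1 := by rw [← sub_eq_zero.mp h, norm_one]
  rw [norm_pow] at h1
  exact (pow_lt_one₀ (norm_nonneg p) hp n.succ_ne_zero).ne h1

theorem eulerCoeff_zero (p : ℂ) : eulerCoeff p 0 = 1 := by
  simp [eulerCoeff, pochN]

theorem eulerCoeff_succ (p : ℂ) (n : ℕ) :
    eulerCoeff p (n + 1) = -p ^ n / (1 - p ^ (n + 1)) * eulerCoeff p n := by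
  have h : pochN p p (n + 1) = pochN p p n * (1 - p ^ (n + 1)) := by
    rw [pochN, Finset.prod_range_succ, ← pochN, pow_succ' p n]
  rw [eulerCoeff, eulerCoeff, h, Nat.choose_succ_succ' n 1, Nat.choose_one_right, pow_add, pow_succ,
    div_mul_div_comm, mul_comm (1 - p ^ (n + 1))]
  congr 1
  ring

theorem summable_norm_eulerCoeff_mul_pow {p : ℂ} (hp : ‖p‖ < 1) (x : ℂ) :
    Summable fun n => ‖eulerCoeff p n * x ^ n‖ := by
  have hlim : Tendsto (fun n : ℕ => ‖-p ^ n / (1 - p ^ (n + 1)) * x‖) atTop (nhds 0) := by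
    have h0 := tendsto_pow_atTop_nhds_zero_of_norm_lt_one hp
    have h1 := (tendsto_add_atTop_iff_nat 1).2 h0
    have h2 := ((h0.neg.div (h1.const_sub 1) (by simp)).mul_const x).norm
    simpa using h2
  refine summable_of_ratio_norm_eventually_le (r := 1 / 2) (by norm_num) ?_
  filter_upwards [hlim.eventually_le_const (show (0 : ℝ) < 1 / 2 by norm_num)] with n hn
  have h : eulerCoeff p (n + 1) * x ^ (n + 1)
      = (-p ^ n / (1 - p ^ (n + 1)) * x) * (eulerCoeff p n * x ^ n) := by
    rw [eulerCoeff_succ]; ring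
  rw [h, norm_norm, norm_norm, norm_mul]
  gcongr

theorem summable_norm_eulerCoeff_succ_mul_pow {p : ℂ} (hp : ‖p‖ < 1) (x : ℂ) :
    Summable fun n => ‖eulerCoeff p (n + 1) * x ^ n‖ := by
  rcases eq_or_ne x 0 with rfl | hx
  · refine summable_of_ne_finset_zero (s := {0}) fun n hn => ?_
    simp_all
  · have h := ((summable_nat_add_iff 1).2 (summable_norm_eulerCoeff_mul_pow hp x)).mul_left ‖x⁻¹‖
    refine h.congr fun n => ?_
    rw [← norm_mul]
    congr 1
    field_simp
    ring

/-- The functional equation of Euler's series. -/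
theorem tsum_eulerCoeff_mul_pow {p : ℂ} (hp : ‖p‖ < 1) (x : ℂ) :
    ∑' n, eulerCoeff p n * x ^ n = (1 - x) * ∑' n, eulerCoeff p n * (x * p) ^ n := by
  have hx := (summable_norm_eulerCoeff_mul_pow hp x).of_norm
  have hxp := (summable_norm_eulerCoeff_mul_pow hp (x * p)).of_norm
  have key : ∑' n, (eulerCoeff p n * x ^ n - eulerCoeff p n * (x * p) ^ n)
      = -x * ∑' n, eulerCoeff p n * (x * p) ^ n := by
    rw [(hx.sub hxp).tsum_eq_zero_add, ← tsum_mul_left]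
    simp only [pow_zero, sub_self, zero_add]
    refine tsum_congr fun n => ?_
    have := one_sub_pow_succ_ne_zero hp n
    rw [eulerCoeff_succ, mul_pow, mul_pow]
    field_simp
    ring
  rw [hx.tsum_sub hxp] at key
  linear_combination key

theorem tsum_eulerCoeff_mul_pow_eq_pochN_mul {p : ℂ} (hp : ‖p‖ < 1) (x : ℂ) (N : ℕ) :
    ∑' n, eulerCoeff p n * x ^ n
      = pochN x p N * ∑' n, eulerCoeff p n * (x * p ^ N) ^ n := by
  induction N with
  | zero => simp [pochN]
  | succ N ih =>
    rw [ih, tsum_eulerCoeff_mul_pow hp (x * p ^ N), pochN, pochN, Finset.prod_range_succ, pow_succ,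
      mul_assoc, mul_assoc]

theorem tendsto_pochN {p : ℂ} (hp : ‖p‖ < 1) (x : ℂ) :
    Tendsto (pochN x p) atTop (nhds (pochInf x p)) := by
  have hs : Summable fun j : ℕ => ‖-(x * p ^ j)‖ := by
    have := (summable_geometric_of_lt_one (norm_nonneg p) hp).mul_left ‖x‖
    simpa using this
  have hm := multipliable_one_add_of_summable hs
  simp only [← sub_eq_add_neg] at hm
  exact hm.hasProd.tendsto_prod_nat

/-- Euler's expansion of the infinite Pochhammer symbol. -/
theorem pochInf_eq_tsum {p : ℂ} (hp : ‖p‖ < 1) (x : ℂ) :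
    pochInf x p = ∑' n, eulerCoeff p n * x ^ n := by
  have hlim : Tendsto (fun N : ℕ => ∑' n, eulerCoeff p n * (x * p ^ N) ^ n) atTop
      (nhds (∑' n, eulerCoeff p n * 0 ^ n)) := by
    refine tendsto_tsum_of_dominated_convergence (summable_norm_eulerCoeff_mul_pow hp x)
      (fun n => ?_) (Eventually.of_forall fun N n => ?_)
    · have h0 := (tendsto_pow_atTop_nhds_zero_of_norm_lt_one hp).const_mul x
      rw [mul_zero] at h0
      exact (h0.pow n).const_mul _
    · simp only [norm_mul, norm_pow]
      gcongr
      exact mul_le_of_le_one_right (norm_nonneg x) (pow_le_one₀ (norm_nonneg p) hp.le)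
  have h1 : ∑' n, eulerCoeff p n * (0 : ℂ) ^ n = 1 := by
    rw [tsum_eq_single 0 fun n hn => by simp [hn]]
    simp [eulerCoeff_zero]
  rw [h1] at hlim
  have h2 := (tendsto_pochN hp x).mul hlim
  simp only [← tsum_eulerCoeff_mul_pow_eq_pochN_mul hp x, mul_one] at h2
  exact tendsto_nhds_unique h2 tendsto_const_nhds

/-- Splitting Euler's expansion into its even and odd parts. -/
theorem pochInf_eq_even_add_odd {p : ℂ} (hp : ‖p‖ < 1) (x : ℂ) :
    pochInf x p = ∑' n, eulerCoeff p (2 * n) * (x ^ 2) ^ n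
      + x * ∑' n, eulerCoeff p (2 * n + 1) * (x ^ 2) ^ n := by
  have hs := (summable_norm_eulerCoeff_mul_pow hp x).of_norm
  have he : Summable fun n => eulerCoeff p (2 * n) * x ^ (2 * n) :=
    hs.comp_injective (i := fun n => 2 * n) fun a b h => by simpa using h
  have ho : Summable fun n => eulerCoeff p (2 * n + 1) * x ^ (2 * n + 1) :=
    hs.comp_injective (i := fun n => 2 * n + 1) fun a b h => by simpa using h
  rw [pochInf_eq_tsum hp,
    ← tsum_even_add_odd (f := fun n => eulerCoeff p n * x ^ n) he ho, ← tsum_mul_left]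
  congr 1
  · simp only [pow_mul]
  · refine tsum_congr fun n => ?_
    rw [pow_succ, pow_mul]
    ring

theorem pochN_neg_two_mul (q : ℂ) (n : ℕ) :
    pochN (-q) (-q) (2 * n) = pochN (q ^ 2) (q ^ 2) n * pochN (-q) (q ^ 2) n := by
  induction n with
  | zero => simp [pochN]
  | succ n ih =>
    have he : (-q) ^ (2 * n) = (q ^ 2) ^ n := by rw [pow_mul, neg_sq]
    simp only [pochN] at ih ⊢
    rw [mul_add, mul_one, Finset.prod_range_succ, Finset.prod_range_succ, ih,
      Finset.prod_range_succ, Finset.prod_range_succ, pow_succ (-q), he]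
    ring

theorem pochN_neg_two_mul_add_one (q : ℂ) (n : ℕ) :
    pochN (-q) (-q) (2 * n + 1) = pochN (q ^ 2) (q ^ 2) n * pochN (-q) (q ^ 2) (n + 1) := by
  rw [pochN, Finset.prod_range_succ, ← pochN, pochN_neg_two_mul, pochN, pochN, pochN,
    Finset.prod_range_succ _ n, pow_mul, neg_sq, mul_assoc]

theorem eulerCoeff_neg_two_mul (q y : ℂ) (n : ℕ) :
    eulerCoeff (-q) (2 * n) * y ^ n
      = (-y) ^ n * q ^ (2 * n ^ 2 - n) / (pochN (q ^ 2) (q ^ 2) n * pochN (-q) (q ^ 2) n) := by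
  have hc : (2 * n).choose 2 = 2 * n ^ 2 - n := by
    rw [Nat.choose_two_right, mul_assoc, Nat.mul_div_cancel_left _ two_pos, Nat.mul_sub, mul_one]
    congr 1
    ring
  have hsign : (-1 : ℂ) ^ (2 * n ^ 2 - n) = (-1) ^ n := by
    refine neg_one_pow_congr ?_
    rw [Nat.even_sub (by nlinarith [Nat.le_self_pow two_ne_zero n])]
    simp
  rw [eulerCoeff, hc, pochN_neg_two_mul, neg_pow q, hsign, pow_mul, neg_one_sq, one_pow,
    neg_pow y]
  ring

theorem eulerCoeff_neg_two_mul_add_one (q y : ℂ) (n : ℕ) :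
    eulerCoeff (-q) (2 * n + 1) * y ^ n
      = -((-y) ^ n * q ^ (2 * n ^ 2 + n)
          / (pochN (q ^ 2) (q ^ 2) n * pochN (-q) (q ^ 2) (n + 1))) := by
  have hc : (2 * n + 1).choose 2 = 2 * n ^ 2 + n := by
    rw [Nat.choose_two_right, Nat.add_sub_cancel, mul_left_comm,
      Nat.mul_div_cancel_left _ two_pos]
    ring
  have hsign : (-1 : ℂ) ^ (2 * n ^ 2 + n) = (-1) ^ n := by
    rw [pow_add, pow_mul, neg_one_sq, one_pow, one_mul]
  rw [eulerCoeff, hc, pochN_neg_two_mul_add_one, neg_pow q, hsign, pow_succ, pow_mul, neg_one_sq,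
    one_pow, neg_pow y]
  ring

theorem csqrt_sq (z : ℂ) : csqrt z ^ 2 = z := by
  rw [csqrt, one_div]
  exact Complex.cpow_nat_inv_pow z two_ne_zero

theorem csqrt_ofReal_sq_mul {r : ℝ} (hr : 0 < r) (z : ℂ) :
    csqrt ((r : ℂ) ^ 2 * z) = r * csqrt z := by
  rcases eq_or_ne z 0 with rfl | hz
  · simp [csqrt]
  · have hr0 : (r : ℂ) ≠ 0 := by exact_mod_cast hr.ne'
    have hr2 : (r : ℂ) ^ 2 ≠ 0 := pow_ne_zero 2 hr0
    rw [csqrt, csqrt, Complex.cpow_def_of_ne_zero (mul_ne_zero hr2 hz),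
      Complex.cpow_def_of_ne_zero hz, ← Complex.ofReal_pow, Complex.log_ofReal_mul (pow_pos hr 2) hz,
      add_mul, Complex.exp_add, Real.log_pow]
    congr 1
    push_cast
    rw [mul_one_div, mul_div_cancel_left₀ _ two_ne_zero, ← Complex.ofReal_exp, Real.exp_log hr]

theorem csqrt_mul_csqrt {T : ℝ} (hT : 0 < T) :
    csqrt ((1 - (T : ℂ)) / (1 + (T : ℂ))) * csqrt (1 - (T : ℂ) ^ 2) = 1 - T := by
  have h1 : (0 : ℝ) < 1 + T := by linarith
  have h1' : (1 + (T : ℂ)) ≠ 0 := by exact_mod_cast h1.ne'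
  have h : 1 - (T : ℂ) ^ 2 = ((1 + T : ℝ) : ℂ) ^ 2 * ((1 - (T : ℂ)) / (1 + (T : ℂ))) := by
    push_cast
    field_simp
    ring
  rw [h, csqrt_ofReal_sq_mul h1, mul_left_comm, ← sq, csqrt_sq]
  push_cast
  field_simp

/-- The `q`-hypergeometric representation of `H*(T;q)`. -/
theorem stmt4 (T : ℝ) (hT : 0 < T) (q : ℂ) (hq : ‖q‖ < 1) :
    Summable (fun n : ℕ =>
      ‖((T:ℂ)^2 - 1)^n * q^(2*n^2+n) / (pochN (q^2) (q^2) n * pochN (-q) (q^2) (n+1))‖) ∧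
    Summable (fun n : ℕ =>
      ‖((T:ℂ)^2 - 1)^n * q^(2*n^2-n) / (pochN (q^2) (q^2) n * pochN (-q) (q^2) n)‖) ∧
    Hstar T q =
      (1 - 1/(T:ℂ)) *
        ∑' n : ℕ, ((T:ℂ)^2 - 1)^n * q^(2*n^2+n) / (pochN (q^2) (q^2) n * pochN (-q) (q^2) (n+1))
      + (1/(T:ℂ)) *
        ∑' n : ℕ, ((T:ℂ)^2 - 1)^n * q^(2*n^2-n) / (pochN (q^2) (q^2) n * pochN (-q) (q^2) n) := by
  have hp : ‖-q‖ < 1 := by rwa [norm_neg]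
  set s := csqrt (1 - (T : ℂ) ^ 2) with hs
  have hs2 : s ^ 2 = 1 - (T : ℂ) ^ 2 := csqrt_sq _
  have hy : (T : ℂ) ^ 2 - 1 = -s ^ 2 := by rw [hs2]; ring
  rw [hy]
  simp only [← eulerCoeff_neg_two_mul]
  have hodd : ∀ n : ℕ, (-s ^ 2) ^ n * q ^ (2 * n ^ 2 + n)
      / (pochN (q ^ 2) (q ^ 2) n * pochN (-q) (q ^ 2) (n + 1))
      = -(eulerCoeff (-q) (2 * n + 1) * (s ^ 2) ^ n) := fun n => by
    rw [eulerCoeff_neg_two_mul_add_one, neg_neg]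
  simp only [hodd, norm_neg, tsum_neg]
  simp only [← pow_mul]
  refine ⟨(summable_norm_eulerCoeff_succ_mul_pow hp s).comp_injective
      (mul_right_injective₀ (two_ne_zero' ℕ)),
    (summable_norm_eulerCoeff_mul_pow hp s).comp_injective
      (mul_right_injective₀ (two_ne_zero' ℕ)), ?_⟩
  have hcs := csqrt_mul_csqrt hT
  rw [← hs] at hcs
  have hT0 : (T : ℂ) ≠ 0 := by exact_mod_cast hT.ne'
  rw [Hstar, ← hs, pochInf_eq_even_add_odd hp, pochInf_eq_even_add_odd hp, neg_sq, Cp, Cm]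
  simp only [← pow_mul]
  field_simp
  linear_combination (2 * ∑' n, eulerCoeff (-q) (2 * n + 1) * s ^ (2 * n)) * hcs
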